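/- The operator D_0^d : S^δ_{k,0} → S^δ_{k-d,0} (d-th power of the divergence on traceless symbols) is conformally invariant if and only if δ = 1 + (2k - d - 1)/n. -/

import Mathlib

open MvPolynomial

noncomputable section

/-- Polynomial symbols: polynomial functions on `T*ℝⁿ`; `Sum.inl` are the `x` variables,
`Sum.inr` the fiber variables `p`. -/
abbrev PolySym (n : ℕ) := MvPolynomial (Fin n ⊕ Fin n) ℝ

/-- Polynomial functions on `ℝⁿ` (densities are identified with these). -/
abbrev PolyDen (n : ℕ) := MvPolynomial (Fin n) ℝ

/-- Polynomial vector fields on `ℝⁿ`, given by their components. -/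
abbrev PolyVF (n : ℕ) := Fin n → PolyDen n

/-- `∂/∂x^i` on symbols. -/
def dxOp (n : ℕ) (i : Fin n) : Module.End ℝ (PolySym n) := (pderiv (Sum.inl i)).toLinearMap

/-- `∂/∂p_i` on symbols. -/
def dpOp (n : ℕ) (i : Fin n) : Module.End ℝ (PolySym n) := (pderiv (Sum.inr i)).toLinearMap

/-- Multiplication by a symbol. -/
def mulOp (n : ℕ) (q : PolySym n) : Module.End ℝ (PolySym n) := LinearMap.mulLeft ℝ q

/-- The symbol `x^i`. -/
def xVar (n : ℕ) (i : Fin n) : PolySym n := X (Sum.inl i)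

/-- The symbol `p_i`. -/
def pVar (n : ℕ) (i : Fin n) : PolySym n := X (Sum.inr i)

/-- A polynomial in `x` viewed as a symbol. -/
def liftX (n : ℕ) (f : PolyDen n) : PolySym n := rename Sum.inl f

/-- Divergence of a vector field. -/
def divVF (n : ℕ) (Xf : PolyVF n) : PolyDen n := ∑ i, pderiv i (Xf i)

/-- Weight function computing the degree in the `p` variables. -/
def pwt (n : ℕ) : Fin n ⊕ Fin n → ℕ := Sum.elim (fun _ => 0) (fun _ => 1)

/-- Homogeneity of degree `k` in the fiber variables `p`. -/
def IsPHomog (n : ℕ) (P : PolySym n) (k : ℕ) : Prop := IsWeightedHomogeneous (pwt n) P k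

/-- The weight-`δ` action `L^δ_X = X^i ∂_{x^i} - p_j (∂_{x^i} X^j) ∂_{p_i} + δ Div(X)` of a
vector field on symbols. -/
def Lop (n : ℕ) (δ : ℝ) (Xf : PolyVF n) : Module.End ℝ (PolySym n) :=
  (∑ i, mulOp n (liftX n (Xf i)) ∘ₗ dxOp n i)
    - (∑ i, ∑ j, mulOp n (pVar n j * liftX n (pderiv i (Xf j))) ∘ₗ dpOp n i)
    + δ • mulOp n (liftX n (divVF n Xf))

/-- The action `ℓ^λ_X = X + λ Div(X)` of a vector field on `λ`-densities. -/
def ellOp (n : ℕ) (lam : ℝ) (Xf : PolyVF n) : Module.End ℝ (PolyDen n) :=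
  (∑ i, LinearMap.mulLeft ℝ (Xf i) ∘ₗ (pderiv i).toLinearMap)
    + lam • LinearMap.mulLeft ℝ (divVF n Xf)

/-- Lie bracket of polynomial vector fields. -/
def bracketVF (n : ℕ) (Xf Yf : PolyVF n) : PolyVF n :=
  fun i => ∑ j, (Xf j * pderiv j (Yf i) - Yf j * pderiv j (Xf i))
/-- The trace operator `T = η_{ij} ∂_{p_i} ∂_{p_j}` for the diagonal metric with entries `ε`. -/
def traceOp (n : ℕ) (ε : Fin n → ℝ) : Module.End ℝ (PolySym n) :=
  ∑ i, ε i • (dpOp n i ∘ₗ dpOp n i)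

/-- The Euler operator `E = p_i ∂_{p_i}`. -/
def eulerOp (n : ℕ) : Module.End ℝ (PolySym n) := ∑ i, mulOp n (pVar n i) ∘ₗ dpOp n i

/-- The quadratic symbol `R = η^{ij} p_i p_j` (the metric). -/
def rQuad (n : ℕ) (ε : Fin n → ℝ) : PolySym n := ∑ i, ε i • (pVar n i * pVar n i)

/-- Multiplication by the metric symbol `R`. -/
def rOp (n : ℕ) (ε : Fin n → ℝ) : Module.End ℝ (PolySym n) := mulOp n (rQuad n ε)

/-- The divergence operator `D = ∂_{x^i} ∂_{p_i}` on symbols. -/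
def divOp (n : ℕ) : Module.End ℝ (PolySym n) := ∑ i, dxOp n i ∘ₗ dpOp n i

/-- The gradient operator `G = η^{ij} p_i ∂_{x^j}`. -/
def gradOp (n : ℕ) (ε : Fin n → ℝ) : Module.End ℝ (PolySym n) :=
  ∑ i, ε i • (mulOp n (pVar n i) ∘ₗ dxOp n i)

/-- The translation vector field `∂_i`. -/
def transVF (n : ℕ) (i : Fin n) : PolyVF n := fun j => if j = i then 1 else 0

/-- The dilation vector field `x^i ∂_i`. -/
def dilVF (n : ℕ) : PolyVF n := fun j => X j

/-- The rotation vector field `x_j ∂_i - x_i ∂_j` for the diagonal metric `ε`. -/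
def rotVF (n : ℕ) (ε : Fin n → ℝ) (i j : Fin n) : PolyVF n :=
  fun m => (if m = i then ε j • X j else 0) - (if m = j then ε i • X i else 0)

/-- The conformal inversion `X_i = x_j x^j ∂_i - 2 x_i x^j ∂_j`. -/
def invVF (n : ℕ) (ε : Fin n → ℝ) (i : Fin n) : PolyVF n :=
  fun j => (if j = i then ∑ m, ε m • (X m * X m) else 0) - (2 * ε i) • (X i * X j)

/-- Generators of the conformal Lie algebra: translations, rotations, the dilation and the
conformal inversions. -/
def confGenSet (n : ℕ) (ε : Fin n → ℝ) : Set (PolyVF n) :=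
  Set.range (transVF n) ∪ {Xf | ∃ i j, Xf = rotVF n ε i j} ∪ {dilVF n} ∪
    Set.range (invVF n ε)

theorem aux_comm_gen {σ : Type} (u v : σ) (P : MvPolynomial σ ℝ) :
    pderiv u (pderiv v P) = pderiv v (pderiv u P) := by
  classical
  have h : ⁅(pderiv u : Derivation ℝ (MvPolynomial σ ℝ) (MvPolynomial σ ℝ)),
      (pderiv v : Derivation ℝ (MvPolynomial σ ℝ) (MvPolynomial σ ℝ))⁆ = 0 := by
    apply MvPolynomial.derivation_ext
    intro i
    rw [Derivation.commutator_apply, pderiv_X, pderiv_X]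
    simp only [Pi.single_apply]
    split_ifs <;> simp
  have := congrArg (fun D => D P) h
  simpa [Derivation.commutator_apply, sub_eq_zero] using this

theorem aux_dx_comm (n : ℕ) (u v : Fin n ⊕ Fin n) (P : PolySym n) :
    pderiv u (pderiv v P) = pderiv v (pderiv u P) := aux_comm_gen u v P

theorem aux_dx_lift (n : ℕ) (i : Fin n) (f : PolyDen n) :
    pderiv (Sum.inl i) (liftX n f) = liftX n (pderiv i f) := by
  unfold liftX
  induction f using MvPolynomial.induction_on with
  | C a => simp
  | add p q hp hq => simp [hp, hq]
  | mul_X p j hp =>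
    rcases eq_or_ne j i with rfl | h
    · simp [Derivation.leibniz, hp]
    · have h2 : (Sum.inl j : Fin n ⊕ Fin n) ≠ Sum.inl i := by simpa using h
      simp [Derivation.leibniz, hp, pderiv_X_of_ne h, pderiv_X_of_ne h2]

theorem aux_dp_lift (n : ℕ) (i : Fin n) (f : PolyDen n) :
    pderiv (Sum.inr i) (liftX n f) = 0 := by
  unfold liftX
  induction f using MvPolynomial.induction_on with
  | C a => simp
  | add p q hp hq => simp [hp, hq]
  | mul_X p j hp => simp [Derivation.leibniz, hp]

theorem aux_div_apply (n : ℕ) (P : PolySym n) :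
    divOp n P = ∑ a, pderiv (Sum.inl a) (pderiv (Sum.inr a) P) := by
  simp [divOp, dxOp, dpOp]

theorem aux_div_lift (n : ℕ) (f : PolyDen n) (Q : PolySym n) :
    divOp n (liftX n f * Q) = liftX n f * divOp n Q
      + ∑ a, liftX n (pderiv a f) * pderiv (Sum.inr a) Q := by
  simp only [aux_div_apply, Derivation.leibniz, aux_dp_lift, aux_dx_lift, smul_eq_mul, mul_zero,
    add_zero, Finset.mul_sum, ← Finset.sum_add_distrib]
  exact Finset.sum_congr rfl fun a _ => by ring

theorem aux_div_p (n : ℕ) (j : Fin n) (Q : PolySym n) :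
    divOp n (pVar n j * Q) = pVar n j * divOp n Q + pderiv (Sum.inl j) Q := by
  have h : ∀ a : Fin n, pderiv (Sum.inl a) (pderiv (Sum.inr a) (pVar n j * Q))
      = pVar n j * pderiv (Sum.inl a) (pderiv (Sum.inr a) Q)
        + if j = a then pderiv (Sum.inl a) Q else 0 := by
    intro a
    rcases eq_or_ne j a with rfl | h
    · simp [pVar, Derivation.leibniz]
    · simp [pVar, Derivation.leibniz, pderiv_X, h, Pi.single_apply]
  simp only [aux_div_apply, h, Finset.sum_add_distrib, Finset.mul_sum]
  simp

theorem aux_div_d (n : ℕ) (u : Fin n ⊕ Fin n) (Q : PolySym n) :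
    divOp n (pderiv u Q) = pderiv u (divOp n Q) := by
  simp only [aux_div_apply, map_sum]
  refine Finset.sum_congr rfl fun a _ => ?_
  rw [aux_dx_comm n (Sum.inr a) u, aux_dx_comm n (Sum.inl a) u]

theorem aux_L_apply (n : ℕ) (δ : ℝ) (Xf : PolyVF n) (P : PolySym n) :
    Lop n δ Xf P = (∑ i, liftX n (Xf i) * pderiv (Sum.inl i) P)
      - (∑ i, ∑ j, pVar n j * (liftX n (pderiv i (Xf j)) * pderiv (Sum.inr i) P))
      + δ • (liftX n (divVF n Xf) * P) := by
  simp [Lop, mulOp, dxOp, dpOp, mul_assoc]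

theorem aux_comm (n : ℕ) (δ : ℝ) (Xf : PolyVF n) (P : PolySym n) :
    divOp n (Lop n δ Xf P) = Lop n δ Xf (divOp n P)
      + (δ - 1) • (∑ a, liftX n (pderiv a (divVF n Xf)) * pderiv (Sum.inr a) P)
      - ∑ i, ∑ j, ∑ a, pVar n j * (liftX n (pderiv a (pderiv i (Xf j)))
          * pderiv (Sum.inr a) (pderiv (Sum.inr i) P)) := by
  have e1 : ∑ a, liftX n (pderiv a (divVF n Xf)) * pderiv (Sum.inr a) P
      = ∑ i, ∑ j, liftX n (pderiv j (pderiv i (Xf j))) * pderiv (Sum.inr i) P := by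
    refine Finset.sum_congr rfl fun a _ => ?_
    rw [← Finset.sum_mul, divVF, map_sum, liftX, map_sum]
    congr 1
    refine Finset.sum_congr rfl fun j _ => ?_
    rw [aux_comm_gen a j]; rfl
  have e2 : ∑ i, ∑ a, liftX n (pderiv a (Xf i)) * pderiv (Sum.inr a) (pderiv (Sum.inl i) P)
      = ∑ i, ∑ j, liftX n (pderiv i (Xf j)) * pderiv (Sum.inl j) (pderiv (Sum.inr i) P) := by
    rw [Finset.sum_comm]
    refine Finset.sum_congr rfl fun a _ => Finset.sum_congr rfl fun j _ => ?_
    rw [aux_dx_comm]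
  simp only [aux_L_apply, map_add, map_sub, map_smul, map_sum, aux_div_lift, aux_div_p, aux_div_d,
    Derivation.leibniz, smul_eq_mul, aux_dx_lift, mul_add, Finset.sum_add_distrib, Finset.mul_sum,
    smul_add, sub_smul, one_smul]
  have e3 : ∑ i, ∑ j, pderiv (Sum.inr i) P * liftX n (pderiv j (pderiv i (Xf j)))
      = ∑ i, ∑ j, liftX n (pderiv j (pderiv i (Xf j))) * pderiv (Sum.inr i) P := by
    exact Finset.sum_congr rfl fun i _ => Finset.sum_congr rfl fun j _ => mul_comm _ _
  rw [e2, e3, ← e1]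
  abel

theorem aux_trace_apply (n : ℕ) (ε : Fin n → ℝ) (P : PolySym n) :
    traceOp n ε P = ∑ a, ε a • pderiv (Sum.inr a) (pderiv (Sum.inr a) P) := by
  simp [traceOp, dpOp]

theorem aux_euler_apply (n : ℕ) (P : PolySym n) :
    eulerOp n P = ∑ a, pVar n a * pderiv (Sum.inr a) P := by
  simp [eulerOp, mulOp, dpOp]

theorem aux_trace_d (n : ℕ) (ε : Fin n → ℝ) (u : Fin n ⊕ Fin n) (Q : PolySym n) :
    traceOp n ε (pderiv u Q) = pderiv u (traceOp n ε Q) := by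
  simp only [aux_trace_apply, map_sum]
  refine Finset.sum_congr rfl fun a _ => ?_
  rw [aux_dx_comm n (Sum.inr a) u, aux_dx_comm n (Sum.inr a) u, Derivation.map_smul]

theorem aux_euler_dx (n : ℕ) (a : Fin n) (Q : PolySym n) :
    eulerOp n (pderiv (Sum.inl a) Q) = pderiv (Sum.inl a) (eulerOp n Q) := by
  simp only [aux_euler_apply, map_sum]
  refine Finset.sum_congr rfl fun b _ => ?_
  rw [aux_dx_comm n (Sum.inr b)]
  simp [Derivation.leibniz, pVar]

theorem aux_euler_dp (n : ℕ) (a : Fin n) (Q : PolySym n) :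
    eulerOp n (pderiv (Sum.inr a) Q) = pderiv (Sum.inr a) (eulerOp n Q)
      - pderiv (Sum.inr a) Q := by
  simp only [aux_euler_apply, map_sum]
  rw [eq_sub_iff_add_eq]
  have h : ∀ b : Fin n, pderiv (Sum.inr a) (pVar n b * pderiv (Sum.inr b) Q)
      = pVar n b * pderiv (Sum.inr b) (pderiv (Sum.inr a) Q)
        + if b = a then pderiv (Sum.inr b) Q else 0 := by
    intro b
    rw [Derivation.leibniz, aux_dx_comm n (Sum.inr a)]
    rcases eq_or_ne b a with rfl | h
    · simp [pVar]
    · simp [pVar, pderiv_X, h, Pi.single_apply]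
  simp only [h, Finset.sum_add_distrib]
  simp

theorem aux_trace_div (n : ℕ) (ε : Fin n → ℝ) (P : PolySym n) (h : traceOp n ε P = 0) :
    traceOp n ε (divOp n P) = 0 := by
  simp only [aux_div_apply, map_sum, aux_trace_d, h, map_zero, Finset.sum_const_zero]

theorem aux_euler_div (n : ℕ) (c : ℝ) (P : PolySym n) (h : eulerOp n P = c • P) :
    eulerOp n (divOp n P) = (c - 1) • divOp n P := by
  simp only [aux_div_apply, map_sum, aux_euler_dx, aux_euler_dp, h, Finset.smul_sum]
  refine Finset.sum_congr rfl fun a _ => ?_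
  simp [sub_smul]

theorem aux_ddinv (n : ℕ) (ε : Fin n → ℝ) (m a i j : Fin n) :
    pderiv a (pderiv i (invVF n ε m j)) = C ((if j = m then if i = a then 2 * ε i else 0 else 0)
      - 2 * ε m * ((if m = i then if j = a then 1 else 0 else 0)
        + if j = i then if m = a then 1 else 0 else 0)) := by
  have h : pderiv a (pderiv i (∑ m, ε m • (X m * X m) : PolyDen n))
      = C (if i = a then 2 * ε i else 0) := by
    have h1 : ∀ b : Fin n, pderiv a (pderiv i (ε b • (X b * X b) : PolyDen n))
        = if b = i then C (if i = a then 2 * ε i else 0) else 0 := by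
      intro b
      rcases eq_or_ne b i with rfl | hb
      · rcases eq_or_ne b a with rfl | hc
        · simp only [Derivation.map_smul, Derivation.leibniz, pderiv_X_self, smul_eq_mul, mul_one,
            map_add, if_true]
          rw [smul_eq_C_mul, map_mul, ← one_add_one_eq_two, map_add, C_1]
          ring
        · simp [Derivation.leibniz, pderiv_X_of_ne hc, hc]
      · simp [Derivation.leibniz, pderiv_X_of_ne hb, hb]
    simp only [map_sum, h1]
    simp
  have h2 : pderiv a (pderiv i (X m * X j : PolyDen n))
      = C ((if m = i then if j = a then 1 else 0 else 0)
        + if j = i then if m = a then 1 else 0 else 0) := by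
    simp only [Derivation.leibniz, smul_eq_mul, pderiv_X, Pi.single_apply, map_add]
    split_ifs <;> simp_all [pderiv_X, Pi.single_apply]
  unfold invVF
  rw [map_sub, map_sub, Derivation.map_smul, Derivation.map_smul, h2]
  by_cases hj : j = m
  · rw [if_pos hj, h, if_pos hj, smul_eq_C_mul, ← map_mul, ← map_sub]
  · simp only [hj, if_false, map_zero, map_sub, smul_eq_C_mul, map_mul]

theorem aux_ddiv (n : ℕ) (ε : Fin n → ℝ) (m a : Fin n) :
    pderiv a (divVF n (invVF n ε m)) = C (if m = a then - 2 * n * ε m else 0) := by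
  simp only [divVF, map_sum, aux_ddinv]
  rw [← map_sum]
  congr 1
  simp only [Finset.sum_sub_distrib, ← Finset.mul_sum, Finset.sum_add_distrib]
  by_cases h : m = a <;> simp [h]
  ring

theorem aux_inv (n : ℕ) (ε : Fin n → ℝ) (δ c : ℝ) (m : Fin n) (P : PolySym n)
    (hT : traceOp n ε P = 0) (hE : eulerOp n P = c • P) :
    divOp n (Lop n δ (invVF n ε m) P) = Lop n δ (invVF n ε m) (divOp n P)
      + (2 * ε m * (2 * (c - 1) + n * (1 - δ))) • pderiv (Sum.inr m) P := by
  have hl : ∀ r : ℝ, liftX n (C r) = C r := fun r => by simp [liftX]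
  have h1 : ∑ a, liftX n (pderiv a (divVF n (invVF n ε m))) * pderiv (Sum.inr a) P
      = (- 2 * n * ε m) • pderiv (Sum.inr m) P := by
    simp only [aux_ddiv, hl, ← smul_eq_C_mul, ite_smul, zero_smul]
    simp
  have hEm : ∑ j, pVar n j * pderiv (Sum.inr j) (pderiv (Sum.inr m) P)
      = (c - 1) • pderiv (Sum.inr m) P := by
    rw [← aux_euler_apply, aux_euler_dp, hE, Derivation.map_smul, sub_smul, one_smul]
  have h2 : ∑ i, ∑ j, ∑ a, pVar n j * (liftX n (pderiv a (pderiv i (invVF n ε m j)))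
          * pderiv (Sum.inr a) (pderiv (Sum.inr i) P))
      = (- 2 * ε m * (2 * (c - 1))) • pderiv (Sum.inr m) P := by
    have h3 : ∀ i j a : Fin n, pVar n j * (liftX n (pderiv a (pderiv i (invVF n ε m j)))
          * pderiv (Sum.inr a) (pderiv (Sum.inr i) P))
        = (if j = m then if i = a then
            (2 * ε i) • (pVar n m * pderiv (Sum.inr i) (pderiv (Sum.inr i) P)) else 0 else 0)
          - (2 * ε m) • ((if m = i then if j = a then
              pVar n j * pderiv (Sum.inr j) (pderiv (Sum.inr m) P) else 0 else 0)
            + if j = i then if m = a then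
              pVar n j * pderiv (Sum.inr j) (pderiv (Sum.inr m) P) else 0 else 0) := by
      intro i j a
      rw [aux_ddinv, hl, ← smul_eq_C_mul, mul_smul_comm, sub_smul, mul_smul (2 * ε m), add_smul]
      congr 1
      · split_ifs with h h'
        · rw [h, h']
        · simp
        · simp
      · congr 2
        · split_ifs with h h'
          · rw [← h, ← h', one_smul]
          · simp
          · simp
        · split_ifs with h h'
          · rw [← h, ← h', one_smul, aux_dx_comm]
          · simp
          · simp
    simp only [h3, Finset.sum_sub_distrib, ← Finset.smul_sum, Finset.sum_add_distrib]
    have t1 : ∑ i, ∑ j, ∑ a, (if j = m then if i = a then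
            (2 * ε i) • (pVar n m * pderiv (Sum.inr i) (pderiv (Sum.inr i) P)) else 0 else 0)
        = 0 := by
      have : ∀ i : Fin n, (2 * ε i) • (pVar n m * pderiv (Sum.inr i) (pderiv (Sum.inr i) P))
        = ((2 : ℝ) • pVar n m) * (ε i • pderiv (Sum.inr i) (pderiv (Sum.inr i) P)) := by
        intro i
        rw [smul_mul_smul_comm]
      simp only [this]
      rw [Finset.sum_congr rfl (g := fun i => ((2 : ℝ) • pVar n m)
        * (ε i • pderiv (Sum.inr i) (pderiv (Sum.inr i) P)))]
      · rw [← Finset.mul_sum, ← aux_trace_apply, hT, mul_zero]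
      · intro i _
        rw [Finset.sum_comm]
        simp
    have t2 : ∑ i, ∑ j, ∑ a, (if m = i then if j = a then
              pVar n j * pderiv (Sum.inr j) (pderiv (Sum.inr m) P) else 0 else 0)
        = (c - 1) • pderiv (Sum.inr m) P := by
      rw [← hEm, Finset.sum_comm]
      refine Finset.sum_congr rfl fun j _ => ?_
      rw [Finset.sum_comm]
      simp
    have t3 : ∑ i, ∑ j, ∑ a, (if j = i then if m = a then
              pVar n j * pderiv (Sum.inr j) (pderiv (Sum.inr m) P) else 0 else 0)
        = (c - 1) • pderiv (Sum.inr m) P := by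
      rw [← hEm, Finset.sum_comm]
      refine Finset.sum_congr rfl fun j _ => ?_
      rw [Finset.sum_comm]
      simp
    rw [t1, t2, t3]
    module
  rw [aux_comm, h1, h2]
  module

theorem aux_pow_d (n d : ℕ) (u : Fin n ⊕ Fin n) (Q : PolySym n) :
    (divOp n ^ d) (pderiv u Q) = pderiv u ((divOp n ^ d) Q) := by
  induction d with
  | zero => simp
  | succ d ih => rw [pow_succ', Module.End.mul_apply, Module.End.mul_apply, ih, aux_div_d]

theorem aux_inv_pow (n : ℕ) (ε : Fin n → ℝ) (δ : ℝ) (m : Fin n) (d : ℕ) : ∀ (c : ℝ)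
    (P : PolySym n), traceOp n ε P = 0 → eulerOp n P = c • P →
    (divOp n ^ (d + 1)) (Lop n δ (invVF n ε m) P)
      = Lop n δ (invVF n ε m) ((divOp n ^ (d + 1)) P)
      + (2 * ε m * (d + 1) * (2 * c - (d + 1) - 1 + n * (1 - δ))) •
        pderiv (Sum.inr m) ((divOp n ^ d) P) := by
  induction d with
  | zero =>
    intro c P hT hE
    simp only [zero_add, pow_one, pow_zero, Module.End.one_apply, aux_inv n ε δ c m P hT hE]
    congr 2
    push_cast
    ring
  | succ d ih =>
    intro c P hT hE
    rw [pow_succ, Module.End.mul_apply, aux_inv n ε δ c m P hT hE, map_add, map_smul,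
      ih (c - 1) _ (aux_trace_div n ε P hT) (aux_euler_div n c P hE), aux_pow_d]
    have q : ∀ e : ℕ, (divOp n ^ e) (divOp n P) = (divOp n ^ (e + 1)) P := fun e => by
      rw [pow_succ, Module.End.mul_apply]
    rw [q, q, ← pow_succ]
    push_cast
    module

theorem aux_affine (n : ℕ) (δ : ℝ) (Xf : PolyVF n)
    (h : ∀ a i j, pderiv a (pderiv i (Xf j)) = 0) (d : ℕ) (P : PolySym n) :
    (divOp n ^ d) (Lop n δ Xf P) = Lop n δ Xf ((divOp n ^ d) P) := by
  induction d with
  | zero => simp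
  | succ d ih =>
    rw [pow_succ', Module.End.mul_apply, Module.End.mul_apply, ih, aux_comm]
    simp [divVF, h, liftX]

theorem aux_euler_homog (n k : ℕ) (P : PolySym n) (h : IsPHomog n P k) :
    eulerOp n P = (k : ℝ) • P := by
  have := IsWeightedHomogeneous.sum_weight_X_mul_pderiv h
  rw [aux_euler_apply]
  simpa [Fintype.sum_sum_type, pwt, pVar, Nat.cast_smul_eq_nsmul] using this

/-- Real and imaginary part of `(p_a + √s p_b) ^ m`. -/
def auxAB (n : ℕ) (s : ℝ) (a b : Fin n) : ℕ → PolySym n × PolySym n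
  | 0 => (1, 0)
  | m + 1 => (pVar n a * (auxAB n s a b m).1 + s • (pVar n b * (auxAB n s a b m).2),
      pVar n a * (auxAB n s a b m).2 + pVar n b * (auxAB n s a b m).1)

theorem aux_AB_homog (n : ℕ) (s : ℝ) (a b : Fin n) (m : ℕ) :
    IsPHomog n (auxAB n s a b m).1 m ∧ IsPHomog n (auxAB n s a b m).2 m := by
  have hp : ∀ (a : Fin n) (Q : PolySym n) (m : ℕ), IsPHomog n Q m →
      IsPHomog n (pVar n a * Q) (m + 1) := by
    intro a Q m h
    rw [add_comm]
    exact IsWeightedHomogeneous.mul (isWeightedHomogeneous_X ℝ (pwt n) (Sum.inr a)) h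
  induction m with
  | zero => exact ⟨isWeightedHomogeneous_one _ _, isWeightedHomogeneous_zero _ _ _⟩
  | succ m ih =>
    refine ⟨IsWeightedHomogeneous.add (hp _ _ _ ih.1) ?_,
      IsWeightedHomogeneous.add (hp _ _ _ ih.2) (hp _ _ _ ih.1)⟩
    exact (weightedHomogeneousSubmodule ℝ (pwt n) (m + 1)).smul_mem s (hp _ _ _ ih.2)

theorem aux_AB_dx (n : ℕ) (s : ℝ) (a b c : Fin n) (m : ℕ) :
    pderiv (Sum.inl c) (auxAB n s a b m).1 = 0 ∧ pderiv (Sum.inl c) (auxAB n s a b m).2 = 0 := by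
  induction m with
  | zero => simp [auxAB]
  | succ m ih => simp [auxAB, ih.1, ih.2, Derivation.leibniz, pVar]

theorem aux_AB_dp (n : ℕ) (s : ℝ) (a b c : Fin n) (ha : c ≠ a) (hb : c ≠ b) (m : ℕ) :
    pderiv (Sum.inr c) (auxAB n s a b m).1 = 0 ∧ pderiv (Sum.inr c) (auxAB n s a b m).2 = 0 := by
  induction m with
  | zero => simp [auxAB]
  | succ m ih =>
    have h1 : (Sum.inr a : Fin n ⊕ Fin n) ≠ Sum.inr c := by simpa using ha.symm
    have h2 : (Sum.inr b : Fin n ⊕ Fin n) ≠ Sum.inr c := by simpa using hb.symm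
    simp [auxAB, ih.1, ih.2, Derivation.leibniz, pVar, pderiv_X_of_ne h1, pderiv_X_of_ne h2]

theorem aux_AB_d (n : ℕ) (s : ℝ) (a b : Fin n) (hab : a ≠ b) (m : ℕ) :
    pderiv (Sum.inr a) (auxAB n s a b (m + 1)).1 = ((m : ℝ) + 1) • (auxAB n s a b m).1 ∧
    pderiv (Sum.inr a) (auxAB n s a b (m + 1)).2 = ((m : ℝ) + 1) • (auxAB n s a b m).2 ∧
    pderiv (Sum.inr b) (auxAB n s a b (m + 1)).1 = (((m : ℝ) + 1) * s) • (auxAB n s a b m).2 ∧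
    pderiv (Sum.inr b) (auxAB n s a b (m + 1)).2 = ((m : ℝ) + 1) • (auxAB n s a b m).1 := by
  have h1 : (Sum.inr a : Fin n ⊕ Fin n) ≠ Sum.inr b := by simpa using hab
  have hA : ∀ m, (auxAB n s a b (m + 1)).1
    = X (Sum.inr a) * (auxAB n s a b m).1 + s • (X (Sum.inr b) * (auxAB n s a b m).2) :=
    fun _ => rfl
  have hB : ∀ m, (auxAB n s a b (m + 1)).2
    = X (Sum.inr a) * (auxAB n s a b m).2 + X (Sum.inr b) * (auxAB n s a b m).1 :=
    fun _ => rfl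
  induction m with
  | zero =>
    simp [auxAB, pVar, pderiv_X_of_ne h1, pderiv_X_of_ne h1.symm]
  | succ m ih =>
    obtain ⟨i1, i2, i3, i4⟩ := ih
    rw [hA (m + 1), hB (m + 1)]
    simp only [map_add, Derivation.map_smul, Derivation.leibniz, i1, i2, i3, i4, pderiv_X_self,
      pderiv_X_of_ne h1, pderiv_X_of_ne h1.symm, smul_eq_mul]
    rw [hA m, hB m]
    simp only [smul_eq_C_mul, map_add, map_mul, Nat.cast_add, Nat.cast_one, C_1]
    refine ⟨?_, ?_, ?_, ?_⟩ <;> ring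

theorem aux_AB_ne (n : ℕ) (s : ℝ) (a b : Fin n) (hab : a ≠ b) (m : ℕ) :
    (auxAB n s a b m).1 ≠ 0 := by
  have h : eval (Sum.elim (fun _ => 0) (fun j => if j = a then (1 : ℝ) else 0))
      (auxAB n s a b m).1 = 1 := by
    induction m with
    | zero => simp [auxAB]
    | succ m ih => simp [auxAB, pVar, ih, hab.symm, smul_eval]
  intro h0
  rw [h0] at h
  simp at h

theorem aux_AB_trace (n : ℕ) (ε : Fin n → ℝ) (hε : ∀ i, ε i = 1 ∨ ε i = -1) (a b : Fin n)
    (hab : a ≠ b) (m : ℕ) : traceOp n ε (auxAB n (-(ε a * ε b)) a b m).1 = 0 := by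
  rw [aux_trace_apply]
  rw [Finset.sum_eq_add a b hab (fun c _ hc => by simp [(aux_AB_dp n _ a b c hc.1 hc.2 m).1])
    (by simp) (by simp)]
  match m with
  | 0 => simp [auxAB]
  | 1 =>
    obtain ⟨i1, i2, i3, i4⟩ := aux_AB_d n (-(ε a * ε b)) a b hab 0
    rw [zero_add] at *
    rw [i1, i3]
    simp [auxAB]
  | m + 2 =>
    obtain ⟨i1, i2, i3, i4⟩ := aux_AB_d n (-(ε a * ε b)) a b hab (m + 1)
    obtain ⟨j1, j2, j3, j4⟩ := aux_AB_d n (-(ε a * ε b)) a b hab m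
    rw [i1, i3, Derivation.map_smul, Derivation.map_smul, j1, j4]
    have : ε b * ε b = 1 := by rcases hε b with h | h <;> simp [h]
    simp only [smul_smul, ← add_smul]
    convert zero_smul ℝ _
    linear_combination (-(ε a * (↑(m + 1) + 1) * (m + 1))) * this

theorem aux_witness (n : ℕ) (s : ℝ) (a b : Fin n) (hab : a ≠ b) (m : ℕ) : ∀ l : ℕ,
    ∃ c : ℝ, c ≠ 0 ∧ (divOp n ^ m) (xVar n a ^ m * (auxAB n s a b (l + m)).1)
      = c • (auxAB n s a b l).1 := by
  induction m with
  | zero => intro l; exact ⟨1, one_ne_zero, by simp⟩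
  | succ m ih =>
    intro l
    obtain ⟨c, hc, h⟩ := ih l
    refine ⟨((m : ℝ) + 1) * (((l + m : ℕ) : ℝ) + 1) * c, by positivity, ?_⟩
    have hD : divOp n (xVar n a ^ (m + 1) * (auxAB n s a b (l + (m + 1))).1)
        = (((m : ℝ) + 1) * (((l + m : ℕ) : ℝ) + 1)) •
          (xVar n a ^ m * (auxAB n s a b (l + m)).1) := by
      rw [aux_div_apply, Finset.sum_eq_single a]
      · rw [← add_assoc, Derivation.leibniz, (aux_AB_d n s a b hab (l + m)).1]
        simp [xVar, Derivation.leibniz, (aux_AB_dx n s a b a (l + m)).1, Derivation.leibniz_pow,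
          smul_eq_C_mul]
        ring
      · intro c _ hc
        have h1 : (Sum.inl a : Fin n ⊕ Fin n) ≠ Sum.inl c := by simpa using hc.symm
        rw [aux_dx_comm]
        simp [xVar, Derivation.leibniz, Derivation.leibniz_pow, (aux_AB_dx n s a b c _).1,
          pderiv_X_of_ne h1]
      · simp
    rw [pow_succ, Module.End.mul_apply, hD, map_smul, h, smul_smul]

/-- The operator `D_0^d : S^δ_{k,0} → S^δ_{k-d,0}` (power of the divergence
on traceless symbols) is conformally invariant if and only if `δ = 1 + (2k - d - 1)/n`. -/
theorem divOp_pow_conformally_invariant_iff (n k d : ℕ) (h3 : 3 ≤ n) (hd : 1 ≤ d)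
    (hdk : d ≤ k) (δ : ℝ) (ε : Fin n → ℝ) (hε : ∀ i, ε i = 1 ∨ ε i = -1) :
    (∀ Xf ∈ confGenSet n ε, ∀ P : PolySym n, IsPHomog n P k → traceOp n ε P = 0 →
        Lop n δ Xf ((divOp n ^ d) P) = (divOp n ^ d) (Lop n δ Xf P))
      ↔ δ = 1 + (2 * (k : ℝ) - (d : ℝ) - 1) / (n : ℝ) := by
  obtain ⟨d, rfl⟩ : ∃ e, d = e + 1 := ⟨d - 1, by omega⟩
  have hn : (n : ℝ) ≠ 0 := by
    have : n ≠ 0 := by omega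
    exact_mod_cast this
  have key : (δ = 1 + (2 * (k : ℝ) - ((d + 1 : ℕ) : ℝ) - 1) / (n : ℝ))
      ↔ 2 * (k : ℝ) - (d + 1) - 1 + n * (1 - δ) = 0 := by
    rw [← sub_eq_iff_eq_add', eq_div_iff hn]
    push_cast
    constructor <;> intro h <;> linarith
  rw [key]
  constructor
  · intro H
    obtain ⟨l, rfl⟩ : ∃ l, k = l + 1 + d := ⟨k - (d + 1), by omega⟩
    let a : Fin n := ⟨0, by omega⟩
    let b : Fin n := ⟨1, by omega⟩
    have hab : a ≠ b := by simp [a, b]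
    set s := -(ε a * ε b) with hs
    set P : PolySym n := xVar n a ^ d * (auxAB n s a b (l + 1 + d)).1 with hP
    have hhom : IsPHomog n P (l + 1 + d) := by
      have h0 : IsWeightedHomogeneous (pwt n) (xVar n a ^ d) 0 := by
        have := (isWeightedHomogeneous_X ℝ (pwt n) (Sum.inl a)).pow d
        simpa [pwt, xVar] using this
      have := h0.mul (aux_AB_homog n s a b (l + 1 + d)).1
      rwa [zero_add] at this
    have hT : traceOp n ε P = 0 := by
      have h1 : ∀ (c : Fin n) (Q : PolySym n), pderiv (Sum.inr c) (xVar n a ^ d * Q)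
          = xVar n a ^ d * pderiv (Sum.inr c) Q := by
        intro c Q
        simp [Derivation.leibniz, Derivation.leibniz_pow, xVar]
      have h2 := aux_AB_trace n ε hε a b hab (l + 1 + d)
      rw [aux_trace_apply] at h2 ⊢
      simp only [hP, h1, ← mul_smul_comm, ← Finset.mul_sum]
      rw [h2, mul_zero]
    have h1 := H (invVF n ε a) (Or.inr ⟨a, rfl⟩) P hhom hT
    rw [aux_inv_pow n ε δ a d _ P hT (aux_euler_homog n _ P hhom)] at h1
    have h2 := left_eq_add.mp h1
    obtain ⟨c, hc, hw⟩ := aux_witness n s a b hab d (l + 1)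
    rw [hw, Derivation.map_smul, (aux_AB_d n s a b hab l).1, smul_smul, smul_smul] at h2
    have hea : ε a ≠ 0 := by rcases hε a with h | h <;> simp [h]
    have h3 := (smul_eq_zero.mp h2).resolve_right (aux_AB_ne n s a b hab l)
    have hd1 : (d : ℝ) + 1 ≠ 0 := by positivity
    have hl1 : (l : ℝ) + 1 ≠ 0 := by positivity
    simpa [hea, hd1, hl1, hc] using h3
  · intro h0 Xf hX P hP hT
    symm
    rcases hX with ((⟨i, rfl⟩ | ⟨i, j, rfl⟩) | rfl) | ⟨i, rfl⟩
    · apply aux_affine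
      intro a b c
      simp only [transVF]
      split_ifs <;> simp
    · apply aux_affine
      intro a b c
      simp only [rotVF]
      split_ifs <;> simp [pderiv_X, Pi.single_apply] <;> split_ifs <;> simp
    · apply aux_affine
      intro a b c
      simp only [dilVF, pderiv_X, Pi.single_apply]
      split_ifs <;> simp
    · rw [aux_inv_pow n ε δ i d _ P hT (aux_euler_homog n _ P hP), h0]
      simp
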